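/- Define G : ℝ → ℝ by G(p) = sup_{y ∈ [0,R]} (H(y) − p y). Then: G(p) = 0 for every p ≥ H'(0); G(p) = −pR for every p ≤ H'(R); and G is differentiable on all of ℝ, with G'(H'(q)) = −q for every q ∈ [0,R]. -/

import Mathlib

open Set

noncomputable section

/-- `G(p) = sup_{y ∈ [0,R]} (H(y) − p y)`. -/
def Gfun (H : ℝ → ℝ) (R p : ℝ) : ℝ := sSup ((fun y => H y - p * y) '' Icc 0 R)

/-- A maximizer of `y ↦ H y - p * y` on `[0,R]` attains the value `Gfun H R p`. -/
lemma Gfun_eq_of_isMaxOn {H : ℝ → ℝ} {R p q : ℝ} (hq : q ∈ Icc 0 R)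
    (hmax : IsMaxOn (fun y => H y - p * y) (Icc 0 R) q) : Gfun H R p = H q - p * q :=
  IsGreatest.csSup_eq ⟨mem_image_of_mem _ hq, forall_mem_image.2 fun _ hy => hmax hy⟩

lemma exists_isMaxOn_sub_mul {H : ℝ → ℝ} {R : ℝ} (hR : 0 ≤ R) (hH : ContinuousOn H (Icc 0 R))
    (p : ℝ) : ∃ q ∈ Icc 0 R, IsMaxOn (fun y => H y - p * y) (Icc 0 R) q :=
  isCompact_Icc.exists_isMaxOn (nonempty_Icc.2 hR) (by fun_prop)

/-- The graph of a concave function lies below its tangent lines. -/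
lemma ConcaveOn.le_tangent {f : ℝ → ℝ} {S : Set ℝ} (hf : ConcaveOn ℝ S f) {x y f' : ℝ}
    (hx : x ∈ S) (hy : y ∈ S) (hf' : HasDerivAt f f' x) : f y ≤ f x + f' * (y - x) := by
  rcases lt_trichotomy x y with h | rfl | h
  · have := hf.slope_le_of_hasDerivAt hx hy h hf'
    rw [slope_def_field, div_le_iff₀ (sub_pos.2 h)] at this
    linarith
  · simp
  · have := hf.le_slope_of_hasDerivAt hy hx h hf'
    rw [slope_def_field, le_div_iff₀ (sub_pos.2 h)] at this
    linarith

/-- A strict maximizer of a continuous function on a compact set beats all points far from it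
by a uniform margin. -/
lemma IsCompact.exists_gap_of_strict_max {X : Type*} [PseudoMetricSpace X] {K : Set X}
    (hK : IsCompact K) {f : X → ℝ} (hf : ContinuousOn f K) {q : X}
    (hmax : ∀ y ∈ K, y ≠ q → f y < f q) {ε : ℝ} (hε : 0 < ε) :
    ∃ δ > 0, ∀ y ∈ K, ε ≤ dist y q → f y + δ ≤ f q := by
  have hcl : IsClosed {y | ε ≤ dist y q} := isClosed_le (by fun_prop) (by fun_prop)
  rcases (K ∩ {y | ε ≤ dist y q}).eq_empty_or_nonempty with h | h
  · exact ⟨1, one_pos, fun y hy hd => (h.subset ⟨hy, hd⟩).elim⟩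
  · obtain ⟨z, ⟨hzK, hz⟩, hzmax⟩ :=
      (hK.inter_right hcl).exists_isMaxOn h (hf.mono inter_subset_left)
    have hzq : z ≠ q := by
      rintro rfl
      simp only [mem_ofPred_eq, dist_self] at hz
      exact hε.not_ge hz
    refine ⟨f q - f z, sub_pos.2 (hmax z hzK hzq), fun y hy hd => ?_⟩
    have : f y ≤ f z := hzmax ⟨hy, hd⟩
    linarith

/-- Envelope theorem: where the maximizer `q` is unique, `Gfun H R` has derivative `-q`. -/
lemma hasDerivAt_Gfun_of_strict_max {H : ℝ → ℝ} {R p q : ℝ} (hH : ContinuousOn H (Icc 0 R))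
    (hq : q ∈ Icc 0 R) (hmax : ∀ y ∈ Icc 0 R, y ≠ q → H y - p * y < H q - p * q) :
    HasDerivAt (Gfun H R) (-q) p := by
  have hR : 0 ≤ R := hq.1.trans hq.2
  have hmax' : IsMaxOn (fun y => H y - p * y) (Icc 0 R) q := fun y hy => by
    rcases eq_or_ne y q with rfl | h
    · exact le_refl (H y - p * y)
    · exact (hmax y hy h).le
  rw [hasDerivAt_iff_isLittleO, Asymptotics.isLittleO_iff]
  intro ε hε
  obtain ⟨δ, hδ, hgap⟩ := isCompact_Icc.exists_gap_of_strict_max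
    (f := fun y => H y - p * y) (by fun_prop) hmax hε
  filter_upwards [Metric.ball_mem_nhds p (ε := δ / (R + 1)) (by positivity)] with p' hp'
  rw [Metric.mem_ball, Real.dist_eq, lt_div_iff₀ (by positivity)] at hp'
  obtain ⟨q', hq', hmaxq'⟩ := exists_isMaxOn_sub_mul hR hH p'
  rw [Gfun_eq_of_isMaxOn hq hmax', Gfun_eq_of_isMaxOn hq' hmaxq']
  have lower : H q - p' * q ≤ H q' - p' * q' := hmaxq' hq
  have upper : H q' - p * q' ≤ H q - p * q := hmax' hq'
  have hqq : |q' - q| ≤ R := abs_sub_le_iff.2 ⟨by linarith [hq'.2, hq.1], by linarith [hq.2, hq'.1]⟩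
  have hprod : (p' - p) * (q - q') ≤ |p' - p| * |q' - q| := by
    rw [abs_sub_comm q' q, ← abs_mul]
    exact le_abs_self _
  have hclose : |q' - q| ≤ ε := by
    by_contra! h
    have := hgap q' hq' h.le
    have := mul_le_mul_of_nonneg_left hqq (abs_nonneg (p' - p))
    nlinarith [abs_nonneg (p' - p)]
  have := mul_le_mul_of_nonneg_left hclose (abs_nonneg (p' - p))
  rw [Real.norm_eq_abs, Real.norm_eq_abs, smul_eq_mul, abs_of_nonneg (by linarith)]
  linarith

lemma StrictConcaveOn.hasDerivAt_Gfun {H : ℝ → ℝ} {R p q : ℝ}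
    (hconc : StrictConcaveOn ℝ (Icc 0 R) H) (hH : ContinuousOn H (Icc 0 R)) (hq : q ∈ Icc 0 R)
    (hmax : IsMaxOn (fun y => H y - p * y) (Icc 0 R) q) :
    HasDerivAt (Gfun H R) (-q) p := by
  have hsc : StrictConcaveOn ℝ (Icc 0 R) (fun y => H y - p * y) :=
    hconc.sub_convexOn ((LinearMap.mulLeft ℝ p).convexOn (convex_Icc 0 R))
  refine hasDerivAt_Gfun_of_strict_max hH hq fun y hy hne => (hmax hy).lt_of_ne fun heq => hne ?_
  exact hsc.eq_of_isMaxOn (fun z hz => (hmax hz).trans_eq heq.symm) hmax hy hq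

/-- properties of the Legendre-type transform `G`: it vanishes for
`p ≥ H'(0)`, equals `−pR` for `p ≤ H'(R)`, and is everywhere differentiable with
`G'(H'(q)) = −q` for `q ∈ [0,R]`. -/
theorem Gfun_properties
    (R : ℝ) (hR : 0 < R) (H : ℝ → ℝ) (hH : ContDiff ℝ 1 H)
    (hconc : StrictConcaveOn ℝ (Icc 0 R) H) (h0 : H 0 = 0) (hRv : H R = 0) :
    (∀ p : ℝ, deriv H 0 ≤ p → Gfun H R p = 0) ∧
    (∀ p : ℝ, p ≤ deriv H R → Gfun H R p = -(p * R)) ∧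
    Differentiable ℝ (Gfun H R) ∧
    (∀ q ∈ Icc (0 : ℝ) R, HasDerivAt (Gfun H R) (-q) (deriv H q)) := by
  have hcont : ContinuousOn H (Icc 0 R) := hH.continuous.continuousOn
  have htangent : ∀ q ∈ Icc 0 R, ∀ y ∈ Icc 0 R, H y ≤ H q + deriv H q * (y - q) :=
    fun q hq y hy => hconc.concaveOn.le_tangent hq hy
      (hH.differentiable one_ne_zero q).hasDerivAt
  have hleft : (0 : ℝ) ∈ Icc 0 R := left_mem_Icc.2 hR.le
  have hright : R ∈ Icc 0 R := right_mem_Icc.2 hR.le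
  refine ⟨fun p hp => ?_, fun p hp => ?_, fun p => ?_, fun q hq => ?_⟩
  · rw [Gfun_eq_of_isMaxOn hleft fun y hy => ?_]
    · simp [h0]
    · have := htangent 0 hleft y hy
      have := mul_le_mul_of_nonneg_right hp hy.1
      simp only [mem_ofPred_eq]
      linarith
  · rw [Gfun_eq_of_isMaxOn hright fun y hy => ?_]
    · simp [hRv]
    · have := htangent R hright y hy
      have := mul_le_mul_of_nonneg_right hp (sub_nonneg.2 hy.2)
      simp only [mem_ofPred_eq]
      linarith
  · obtain ⟨q, hq, hmax⟩ := exists_isMaxOn_sub_mul hR.le hcont p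
    exact (hconc.hasDerivAt_Gfun hcont hq hmax).differentiableAt
  · refine hconc.hasDerivAt_Gfun hcont hq fun y hy => ?_
    have := htangent q hq y hy
    simp only [mem_ofPred_eq]
    linarith
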